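/- arXiv:2503.18517 — 7 statements merged into one kernel-verified Lean document; each statement's English description precedes it below -/
import Mathlib

section
/- For every real number α and every real N ≥ 1, there exists p/q ∈ ℚ(H₄) such that |q·α − p| < (√2 + 1)/(2N) and 1 ≤ q ≤ N. -/
/-- A matrix (p, r; q, s) has the first H4 form (without sign). -/
def H4form (p r q s : ℝ) : Prop :=
  (∃ a b c d : ℤ, Odd a ∧ Odd d ∧ a * d - 2 * b * c = 1 ∧
     p = (a : ℝ) ∧ r = Real.sqrt 2 * b ∧ q = Real.sqrt 2 * c ∧ s = (d : ℝ)) ∨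
  (∃ a b c d : ℤ, Odd b ∧ Odd c ∧ 2 * a * d - b * c = 1 ∧
     p = Real.sqrt 2 * a ∧ r = (b : ℝ) ∧ q = (c : ℝ) ∧ s = Real.sqrt 2 * d)

/-- The matrix (p, r; q, s) belongs to the Hecke group H4 (up to sign). -/
def H4 (p r q s : ℝ) : Prop := H4form p r q s ∨ H4form (-p) (-r) (-q) (-s)

/-- p/q ∈ ℚ(H₄): q > 0 and (p, r; q, s) ∈ H₄ for some reals r, s. -/
def QH4 (p q : ℝ) : Prop := 0 < q ∧ ∃ r s : ℝ, H4 p r q s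

/-- α ∉ √2·ℚ. -/
def NotSqrt2Rat (α : ℝ) : Prop := ¬ ∃ x : ℚ, α = Real.sqrt 2 * (x : ℝ)

lemma QH4_of_int_sqrt {a b c d e : ℤ} (hc : 0 < c) (he : e * e = 1)
    (h : a * d - 2 * b * c = e) : QH4 (a : ℝ) (Real.sqrt 2 * c) := by
  have hc' : (0 : ℝ) < c := by exact_mod_cast hc
  have hodd : Odd (a * d) := by
    have he' : Odd e := (Int.odd_mul.1 (he ▸ odd_one)).1
    have : a * d = e + 2 * (b * c) := by linarith
    rw [this]
    exact he'.add_even (even_two_mul _)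
  refine ⟨by positivity, Real.sqrt 2 * (e * b : ℤ), (e * d : ℤ), Or.inl (Or.inl
    ⟨a, e * b, c, e * d, (Int.odd_mul.1 hodd).1, ?_, ?_, rfl, rfl, rfl, rfl⟩)⟩
  · exact Int.odd_mul.2 ⟨(Int.odd_mul.1 (he ▸ odd_one)).1, (Int.odd_mul.1 hodd).2⟩
  · linear_combination e * h + he

lemma QH4_of_sqrt_int {a b c d e : ℤ} (hd : 0 < d) (he : e * e = 1)
    (h : a * d - 2 * b * c = e) : QH4 (Real.sqrt 2 * b) (d : ℝ) := by
  have hodd : Odd (a * d) := by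
    have he' : Odd e := (Int.odd_mul.1 (he ▸ odd_one)).1
    have : a * d = e + 2 * (b * c) := by linarith
    rw [this]
    exact he'.add_even (even_two_mul _)
  refine ⟨by exact_mod_cast hd, (-e * a : ℤ), Real.sqrt 2 * (-e * c : ℤ), Or.inl (Or.inr
    ⟨b, -e * a, d, -e * c, ?_, (Int.odd_mul.1 hodd).2, ?_, rfl, rfl, rfl, rfl⟩)⟩
  · exact Int.odd_mul.2 ⟨(Int.odd_mul.1 (he ▸ odd_one)).1.neg, (Int.odd_mul.1 hodd).1⟩
  · linear_combination e * h + he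

/-- If `α` lies between `p / q` and `p' / q'`, a fraction pair of small determinant,
then one of the two approximates `α` well. -/
lemma abs_lt_or_abs_lt_of_det {q q' x y D δ : ℝ} (hq : 0 < q) (hq' : 0 < q')
    (hxy : x * y ≤ 0) (hD : |q' * x - q * y| ≤ D) (hδ : D < δ * (q + q')) :
    |x| < δ ∨ |y| < δ := by
  by_contra! h
  obtain ⟨hx, hy⟩ := h
  have key : q' * |x| + q * |y| ≤ D := by
    refine le_trans ?_ hD
    rcases le_total 0 x with h0 | h0 <;> rcases le_total 0 y with h1 | h1
    · rcases mul_eq_zero.1 (le_antisymm hxy (mul_nonneg h0 h1)) with h | h <;>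
        simp [h, abs_mul, abs_of_pos hq, abs_of_pos hq']
    · rw [abs_of_nonneg h0, abs_of_nonpos h1]
      exact le_trans (by linarith) (le_abs_self _)
    · rw [abs_of_nonpos h0, abs_of_nonneg h1]
      exact le_trans (by linarith) (neg_le_abs _)
    · rcases mul_eq_zero.1 (le_antisymm hxy (mul_nonneg_of_nonpos_of_nonpos h0 h1)) with h | h <;>
        simp [h, abs_mul, abs_of_pos hq, abs_of_pos hq']
  have h1 := mul_le_mul_of_nonneg_left hx hq'.le
  have h2 := mul_le_mul_of_nonneg_left hy hq.le
  linarith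

lemma exists_QH4_of_det {α N p q p' q' D : ℝ} (h : QH4 p q) (h' : QH4 p' q')
    (hq : 1 ≤ q) (hq' : 1 ≤ q') (hqN : q ≤ N) (hqN' : q' ≤ N)
    (hxy : (q * α - p) * (q' * α - p') ≤ 0) (hD : |q * p' - q' * p| ≤ D)
    (hN : D * (2 * N) < (Real.sqrt 2 + 1) * (q + q')) :
    ∃ p q : ℝ, QH4 p q ∧ |q * α - p| < (Real.sqrt 2 + 1) / (2 * N) ∧ 1 ≤ q ∧ q ≤ N := by
  have hN0 : 0 < 2 * N := by linarith
  have hδ : D < (Real.sqrt 2 + 1) / (2 * N) * (q + q') := by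
    rw [div_mul_eq_mul_div, lt_div_iff₀ hN0]
    exact hN
  have hD' : |q' * (q * α - p) - q * (q' * α - p')| ≤ D := by
    convert hD using 2
    ring
  rcases abs_lt_or_abs_lt_of_det h.1 h'.1 hxy hD' hδ with hx | hx
  exacts [⟨p, q, h, hx, hq, hqN⟩, ⟨p', q', h', hx, hq', hqN'⟩]

/-- Descent through the Farey-type subdivision attached to `H₄`: the interval between the
neighbours `a / (√2 c)` and `√2 b / d` is cut at `√2 (a + b) / (2 c + d)` and
`(a + 2 b) / (√2 (c + d))`. -/
lemma exists_QH4_of_neighbours (α N : ℝ) (n : ℕ) : ∀ a b c d e : ℤ, 0 < c → 0 < d →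
    e * e = 1 → a * d - 2 * b * c = e →
    (Real.sqrt 2 * c * α - a) * (d * α - Real.sqrt 2 * b) ≤ 0 →
    Real.sqrt 2 * c ≤ N → (d : ℝ) ≤ N → 2 * N < c + d + n →
    ∃ p q : ℝ, QH4 p q ∧ |q * α - p| < (Real.sqrt 2 + 1) / (2 * N) ∧ 1 ≤ q ∧ q ≤ N := by
  have s2 : Real.sqrt 2 * Real.sqrt 2 = 2 := Real.mul_self_sqrt (by norm_num)
  have s1 : 1 < Real.sqrt 2 := Real.lt_sqrt_of_sq_lt (by norm_num)
  induction n with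
  | zero =>
    intro a b c d e hc hd he h hxy hcN hdN hn
    have hc' : (1 : ℝ) ≤ c := by exact_mod_cast hc
    push_cast at hn
    nlinarith
  | succ n ih =>
    intro a b c d e hc hd he h hxy hcN hdN hn
    have hc' : (1 : ℝ) ≤ c := by exact_mod_cast hc
    have hd' : (1 : ℝ) ≤ d := by exact_mod_cast hd
    have hsc : 1 ≤ Real.sqrt 2 * c := by nlinarith
    have hscd : 1 ≤ Real.sqrt 2 * (c + d : ℤ) := by push_cast; nlinarith
    have hcd' : (1 : ℝ) ≤ (2 * c + d : ℤ) := by push_cast; linarith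
    push_cast at hn
    have he' : -e * -e = 1 := by linarith
    have hu := QH4_of_int_sqrt hc he h
    have hv := QH4_of_sqrt_int hd he h
    have hdet₁ : a * (2 * c + d) - 2 * (a + b) * c = e := by linear_combination h
    have hdet₂ : (a + 2 * b) * d - 2 * b * (c + d) = e := by linear_combination h
    have hdet₃ : (a + 2 * b) * (2 * c + d) - 2 * (a + b) * (c + d) = -e := by
      linear_combination -h
    have hm₁ := QH4_of_sqrt_int (by omega) he hdet₁
    have hm₂ := QH4_of_int_sqrt (by omega) he hdet₂
    have hR : (a * d - 2 * b * c : ℝ) = e := by exact_mod_cast h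
    have hE : |(e : ℝ)| = 1 := by
      rcases mul_self_eq_one_iff.1 he with rfl | rfl <;> norm_num
    have r₁ := ih a (a + b) c (2 * c + d) e hc (by omega) he hdet₁
    have r₂ := ih (a + 2 * b) b (c + d) d e (by omega) hd he hdet₂
    have r₃ := ih (a + 2 * b) (a + b) (c + d) (2 * c + d) (-e) (by omega) (by omega) he' hdet₃
    obtain ⟨x, hx⟩ : ∃ x, x = Real.sqrt 2 * c * α - a := ⟨_, rfl⟩
    obtain ⟨y, hy⟩ : ∃ y, y = d * α - Real.sqrt 2 * b := ⟨_, rfl⟩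
    have hz : ((2 * c + d : ℤ) : ℝ) * α - Real.sqrt 2 * (a + b : ℤ) = Real.sqrt 2 * x + y := by
      rw [hx, hy]; push_cast; linear_combination (-c * α) * s2
    have hw : Real.sqrt 2 * (c + d : ℤ) * α - (a + 2 * b : ℤ) = x + Real.sqrt 2 * y := by
      rw [hx, hy]; push_cast; linear_combination b * s2
    rw [← hx, hz] at r₁
    rw [← hy, hw] at r₂
    rw [hz, hw] at r₃
    have hxy' := hxy
    rw [← hx, ← hy] at hxy'
    by_cases h₁ : ((2 * c + d : ℤ) : ℝ) ≤ N <;> by_cases h₂ : Real.sqrt 2 * (c + d : ℤ) ≤ N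
    · by_cases g₁ : x * (Real.sqrt 2 * x + y) ≤ 0
      · exact r₁ g₁ hcN h₁ (by push_cast; linarith)
      by_cases g₂ : (x + Real.sqrt 2 * y) * y ≤ 0
      · exact r₂ g₂ h₂ hdN (by push_cast; linarith)
      refine r₃ ?_ h₂ h₁ (by push_cast; linarith)
      push Not at g₁ g₂
      have := mul_pos g₁ g₂
      by_contra! g
      nlinarith [mul_nonneg (neg_nonneg.2 hxy') g.le]
    · by_cases g₁ : x * (Real.sqrt 2 * x + y) ≤ 0
      · exact r₁ g₁ hcN h₁ (by push_cast; linarith)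
      refine exists_QH4_of_det (D := Real.sqrt 2) hm₁ hv hcd' hd' h₁ hdN ?_ ?_ ?_
      · rw [hz, ← hy]
        push Not at g₁
        by_contra! g
        nlinarith [mul_pos g₁ g, mul_nonneg (neg_nonneg.2 hxy')
          (mul_self_nonneg (Real.sqrt 2 * x + y))]
      · have : ((2 * c + d : ℤ) : ℝ) * (Real.sqrt 2 * b) - d * (Real.sqrt 2 * (a + b : ℤ))
            = Real.sqrt 2 * -e := by
          rw [← hR]; push_cast; ring
        rw [this, abs_mul, abs_neg, hE, abs_of_pos (by linarith), mul_one]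
      · push Not at h₂
        push_cast at h₂ ⊢
        nlinarith
    · by_cases g₂ : (x + Real.sqrt 2 * y) * y ≤ 0
      · exact r₂ g₂ h₂ hdN (by push_cast; linarith)
      refine exists_QH4_of_det (D := Real.sqrt 2) hu hm₂ hsc hscd hcN h₂ ?_ ?_ ?_
      · rw [hw, ← hx]
        push Not at g₂
        by_contra! g
        nlinarith [mul_pos g₂ g, mul_nonneg (neg_nonneg.2 hxy')
          (mul_self_nonneg (x + Real.sqrt 2 * y))]
      · have : Real.sqrt 2 * c * (a + 2 * b : ℤ) - Real.sqrt 2 * (c + d : ℤ) * a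
            = Real.sqrt 2 * -e := by
          rw [← hR]; push_cast; ring
        rw [this, abs_mul, abs_neg, hE, abs_of_pos (by linarith), mul_one]
      · push Not at h₁
        push_cast at h₁ ⊢
        nlinarith [mul_lt_mul_of_pos_left h₁ (one_pos.trans s1),
          mul_pos (sub_pos.2 s1) (show 0 < Real.sqrt 2 * (2 * c + d) by nlinarith)]
    · refine exists_QH4_of_det (D := 1) hu hv hsc hd' hcN hdN hxy ?_ ?_
      · have : Real.sqrt 2 * c * (Real.sqrt 2 * b) - d * a = -e := by
          rw [← hR]; linear_combination c * b * s2
        rw [this, abs_neg, hE]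
      · push Not at h₁ h₂
        push_cast at h₁ h₂
        nlinarith

theorem dirichlet_H4 (α : ℝ) (N : ℝ) (hN : 1 ≤ N) :
    ∃ p q : ℝ, QH4 p q ∧ |q * α - p| < (Real.sqrt 2 + 1) / (2 * N) ∧ 1 ≤ q ∧ q ≤ N := by
  have s2 : Real.sqrt 2 * Real.sqrt 2 = 2 := Real.mul_self_sqrt (by norm_num)
  have s1 : 1 < Real.sqrt 2 := Real.lt_sqrt_of_sq_lt (by norm_num)
  have s0 : 0 < Real.sqrt 2 := by linarith
  obtain ⟨n, hn⟩ : ∃ n : ℤ, n = ⌊α / Real.sqrt 2⌋ := ⟨_, rfl⟩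
  have hl : 0 ≤ α - Real.sqrt 2 * n := by
    have := Int.floor_le (α / Real.sqrt 2)
    rw [← hn, le_div_iff₀ s0] at this
    linarith
  have hr : α - Real.sqrt 2 * (n + 1) ≤ 0 := by
    have := Int.lt_floor_add_one (α / Real.sqrt 2)
    rw [← hn, div_lt_iff₀ s0] at this
    linarith
  have hdet : (2 * n + 1) * 1 - 2 * n * 1 = 1 := by ring
  have hdet' : (2 * n + 1) * 1 - 2 * (n + 1) * 1 = -1 := by ring
  by_cases hN2 : Real.sqrt 2 ≤ N
  · obtain ⟨k, hk⟩ := exists_nat_gt (2 * N)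
    rcases le_total 0 (Real.sqrt 2 * (1 : ℤ) * α - (2 * n + 1 : ℤ)) with h | h
    · refine exists_QH4_of_neighbours α N k (2 * n + 1) (n + 1) 1 1 (-1) one_pos one_pos
        (by norm_num) hdet' (mul_nonpos_of_nonneg_of_nonpos h ?_) ?_ ?_ ?_ <;> push_cast <;> linarith
    · refine exists_QH4_of_neighbours α N k (2 * n + 1) n 1 1 1 one_pos one_pos
        (by norm_num) hdet (mul_nonpos_of_nonpos_of_nonneg h ?_) ?_ ?_ ?_ <;> push_cast <;> linarith
  · push Not at hN2
    refine exists_QH4_of_det (D := Real.sqrt 2) (QH4_of_sqrt_int one_pos (by norm_num) hdet)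
      (QH4_of_sqrt_int one_pos (by norm_num) hdet') (by simp) (by simp) (by simpa) (by simpa)
      (mul_nonpos_of_nonneg_of_nonpos ?_ ?_) ?_ ?_
    · push_cast; linarith
    · push_cast; linarith
    · have : ((1 : ℤ) : ℝ) * (Real.sqrt 2 * (n + 1 : ℤ)) - (1 : ℤ) * (Real.sqrt 2 * n)
          = Real.sqrt 2 := by
        push_cast; ring
      rw [this, abs_of_pos s0]
    · push_cast
      nlinarith
end

section
/- If p/q ∈ ℚ(H₄) is an H₄-best approximation of a real number α, then |α − p/q| < 1/q². -/
/-- p/q ∈ ℚ(H₄) is an H₄-best approximation of α. -/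
def IsBest (α p q : ℝ) : Prop :=
  QH4 p q ∧ ∀ r s : ℝ, QH4 r s → r / s ≠ p / q → s ≤ q → |q * α - p| < |s * α - r|

lemma sqrt_two_mul_self_mul (x : ℝ) : Real.sqrt 2 * (Real.sqrt 2 * x) = 2 * x := by
  rw [← mul_assoc, Real.mul_self_sqrt (by norm_num)]

lemma H4form.det_eq_one {p r q s : ℝ} (h : H4form p r q s) : p * s - q * r = 1 := by
  rcases h with ⟨a, b, c, d, -, -, hdet, rfl, rfl, rfl, rfl⟩ |
    ⟨a, b, c, d, -, -, hdet, rfl, rfl, rfl, rfl⟩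
  · have hR : (a : ℝ) * d - 2 * b * c = 1 := by exact_mod_cast hdet
    linear_combination hR - sqrt_two_mul_self_mul ((b : ℝ) * c)
  · have hR : 2 * (a : ℝ) * d - b * c = 1 := by exact_mod_cast hdet
    linear_combination hR + sqrt_two_mul_self_mul ((a : ℝ) * d)

lemma H4form.translate {p r q s : ℝ} (h : H4form p r q s) (k : ℤ) :
    H4form p (r + k * (Real.sqrt 2 * p)) q (s + k * (Real.sqrt 2 * q)) := by
  rcases h with ⟨a, b, c, d, ha, hd, hdet, rfl, rfl, rfl, rfl⟩ |
    ⟨a, b, c, d, hb, hc, hdet, rfl, rfl, rfl, rfl⟩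
  · refine Or.inl ⟨a, b + k * a, c, d + 2 * (k * c), ha, hd.add_even (even_two_mul _), ?_,
      rfl, ?_, rfl, ?_⟩
    · linear_combination hdet
    · push_cast; ring
    · rw [sqrt_two_mul_self_mul]; push_cast; ring
  · refine Or.inr ⟨a, b + 2 * (k * a), c, d + k * c, hb.add_even (even_two_mul _), hc, ?_,
      rfl, ?_, rfl, ?_⟩
    · linear_combination hdet
    · rw [sqrt_two_mul_self_mul]; push_cast; ring
    · push_cast; ring

lemma H4form.swap {p r q s : ℝ} (h : H4form p r q s) : H4form r (-p) s (-q) := by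
  rcases h with ⟨a, b, c, d, ha, hd, hdet, rfl, rfl, rfl, rfl⟩ |
    ⟨a, b, c, d, hb, hc, hdet, rfl, rfl, rfl, rfl⟩
  · refine Or.inr ⟨b, -a, d, -c, ha.neg, hd, ?_, rfl, ?_, rfl, ?_⟩
    · linear_combination hdet
    · push_cast; ring
    · push_cast; ring
  · refine Or.inl ⟨b, -a, d, -c, hb, hc.neg, ?_, rfl, ?_, rfl, ?_⟩
    · linear_combination hdet
    · push_cast; ring
    · push_cast; ring

lemma H4form.conj {p r q s : ℝ} (h : H4form p r q s) : H4form (-p) r q (-s) := by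
  rcases h with ⟨a, b, c, d, ha, hd, hdet, rfl, rfl, rfl, rfl⟩ |
    ⟨a, b, c, d, hb, hc, hdet, rfl, rfl, rfl, rfl⟩
  · refine Or.inl ⟨-a, b, c, -d, ha.neg, hd.neg, ?_, ?_, rfl, rfl, ?_⟩
    · linear_combination hdet
    · push_cast; ring
    · push_cast; ring
  · refine Or.inr ⟨-a, b, c, -d, hb, hc, ?_, ?_, rfl, rfl, ?_⟩
    · linear_combination hdet
    · push_cast; ring
    · push_cast; ring

lemma H4.neg {p r q s : ℝ} (h : H4 p r q s) : H4 (-p) (-r) (-q) (-s) := by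
  simpa [H4, or_comm] using h

lemma H4.det_eq_one {p r q s : ℝ} (h : H4 p r q s) : p * s - q * r = 1 := by
  rcases h with h | h
  · exact h.det_eq_one
  · linear_combination h.det_eq_one

lemma H4.translate {p r q s : ℝ} (h : H4 p r q s) (k : ℤ) :
    H4 p (r + k * (Real.sqrt 2 * p)) q (s + k * (Real.sqrt 2 * q)) := by
  rcases h with h | h
  · exact Or.inl (h.translate k)
  · right
    convert h.translate k using 1 <;> ring

lemma H4.swap {p r q s : ℝ} (h : H4 p r q s) : H4 r (-p) s (-q) :=
  Or.imp H4form.swap H4form.swap h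

lemma H4.conj {p r q s : ℝ} (h : H4 p r q s) : H4 (-p) r q (-s) :=
  Or.imp H4form.conj H4form.conj h

lemma QH4.neg_left {p q : ℝ} (h : QH4 p q) : QH4 (-p) q := by
  obtain ⟨hq, r, s, hM⟩ := h
  exact ⟨hq, r, -s, hM.conj⟩

lemma IsBest.neg {α p q : ℝ} (h : IsBest α p q) : IsBest (-α) (-p) q := by
  refine ⟨h.1.neg_left, fun r s hrs hne hle => ?_⟩
  have key := h.2 (-r) s hrs.neg_left (fun he => hne ?_) hle
  · rw [← abs_neg, ← abs_neg (s * -α - r)]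
    convert key using 2 <;> ring
  · rw [neg_div, ← he, neg_div, neg_neg]

/-- The estimate obtained by comparing a best approximation with a column of negative
denominator. -/
lemma IsBest.mul_sub_lt {α p q r s r' s' D : ℝ} (h : IsBest α p q) (hM : H4 r r' s s')
    (hs : s < 0) (hsq : -s ≤ q) (hdet : p * s - q * r = D) (hD : 0 < D)
    (hη : 0 ≤ q * α - p) : (q * α - p) * (q - s) < D := by
  have hq : 0 < q := h.1.1
  have key := h.2 (-r) (-s) ⟨neg_pos.2 hs, _, _, hM.neg⟩ ?_ hsq
  · rw [abs_of_nonneg hη, lt_abs] at key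
    rcases key with key | key
    · nlinarith [mul_lt_mul_of_pos_left key hq, mul_nonneg hη (by linarith : 0 ≤ q + s)]
    · nlinarith [mul_lt_mul_of_pos_left key hq]
  · rw [neg_div_neg_eq, Ne, div_eq_div_iff hs.ne hq.ne']
    intro he
    linarith

lemma H4.exists_mem_Ico {p r q s : ℝ} (h : H4 p r q s) (hq : 0 < q) :
    ∃ r' s' : ℝ, H4 p r' q s' ∧ -q ≤ s' ∧ s' < -q + Real.sqrt 2 * q := by
  have hL : 0 < Real.sqrt 2 * q := by positivity
  obtain ⟨k, hk, -⟩ := existsUnique_add_zsmul_mem_Ico hL s (-q)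
  rw [zsmul_eq_mul] at hk
  exact ⟨_, _, h.translate k, hk.1, hk.2⟩

lemma IsBest.mul_lt_one {α p q : ℝ} (h : IsBest α p q) (hη : 0 ≤ q * α - p) :
    (q * α - p) * q < 1 := by
  have hq : 0 < q := h.1.1
  obtain ⟨r₀, s₀, hM₀⟩ := h.1.2
  obtain ⟨r, s, hM, hs₁, hs₂⟩ := hM₀.exists_mem_Ico hq
  have hdet := hM.det_eq_one
  have h2 : Real.sqrt 2 * Real.sqrt 2 = 2 := Real.mul_self_sqrt (by norm_num)
  have hpos : 0 < Real.sqrt 2 := by positivity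
  rcases lt_or_ge s 0 with hs | hs
  · have := h.mul_sub_lt hM.swap hs (by linarith) hdet one_pos hη
    nlinarith [mul_nonneg hη (neg_pos.2 hs).le]
  · have hgt : 1 < Real.sqrt 2 := by nlinarith
    have ht : -q + Real.sqrt 2 * s < 0 := by
      have := mul_lt_mul_of_pos_left hs₂ hpos
      nlinarith [mul_lt_mul_of_pos_right hgt hq]
    have hN := (hM.swap.translate 1).swap
    push_cast at hN
    rw [one_mul, one_mul] at hN
    have key := h.mul_sub_lt hN ht (by nlinarith) (D := Real.sqrt 2)
      (by linear_combination Real.sqrt 2 * hdet) hpos hη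
    have key' : (q * α - p) * (Real.sqrt 2 * q - s) < 1 := by
      refine lt_of_mul_lt_mul_left ?_ hpos.le
      linear_combination key + (q * α - p) * q * h2
    nlinarith [mul_nonneg hη (by linarith : 0 ≤ Real.sqrt 2 * q - s - q)]

theorem best_approx_bound (α p q : ℝ) (h : IsBest α p q) :
    |α - p / q| < 1 / q ^ 2 := by
  have hq : 0 < q := h.1.1
  have key : |q * α - p| * q < 1 := by
    rcases abs_cases (q * α - p) with ⟨he, hη⟩ | ⟨he, hη⟩
    · rw [he]
      exact h.mul_lt_one hη
    · rw [he]
      linear_combination h.neg.mul_lt_one (by linarith)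
  have hdiv : α - p / q = (q * α - p) / q := by field_simp
  rw [hdiv, abs_div, abs_of_pos hq, div_lt_div_iff₀ hq (by positivity)]
  nlinarith [mul_lt_mul_of_pos_right key hq]
end

section
/- If p/q ∈ ℚ(H₄) and α is a real number with |α − p/q| < 1/(2q²), then p/q is an H₄-best approximation of α. -/
/-- Numerator and denominator of an element of ℚ(H₄): one is an integer, the other an
integer multiple of `√2`. -/
theorem QH4.exists_int {p q : ℝ} (h : QH4 p q) :
    (∃ a c : ℤ, p = a ∧ q = Real.sqrt 2 * c) ∨ (∃ a c : ℤ, p = Real.sqrt 2 * a ∧ q = c) := by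
  obtain ⟨-, r, s, (⟨a, b, c, d, -, -, -, hp, -, hq, -⟩ | ⟨a, b, c, d, -, -, -, hp, -, hq, -⟩) |
    (⟨a, b, c, d, -, -, -, hp, -, hq, -⟩ | ⟨a, b, c, d, -, -, -, hp, -, hq, -⟩)⟩ := h
  · exact .inl ⟨a, c, hp, hq⟩
  · exact .inr ⟨a, c, hp, hq⟩
  · exact .inl ⟨-a, -c, by push_cast; linarith, by push_cast; linarith⟩
  · exact .inr ⟨-a, -c, by push_cast; linarith, by push_cast; linarith⟩

theorem one_le_abs_intCast {n : ℤ} (hn : (n : ℝ) ≠ 0) : 1 ≤ |(n : ℝ)| := by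
  exact_mod_cast Int.one_le_abs (by exact_mod_cast hn : n ≠ 0)

theorem one_le_abs_sqrt_two_mul_intCast {n : ℤ} (hn : Real.sqrt 2 * n ≠ 0) :
    1 ≤ |Real.sqrt 2 * n| := by
  rw [abs_mul, abs_of_nonneg (Real.sqrt_nonneg 2)]
  exact one_le_mul_of_one_le_of_one_le (Real.one_le_sqrt.mpr one_le_two)
    (one_le_abs_intCast (right_ne_zero_of_mul hn))

/-- Two distinct elements of ℚ(H₄) have determinant at least `1` in absolute value. -/
theorem QH4.one_le_abs_det {p q r s : ℝ} (hpq : QH4 p q) (hrs : QH4 r s)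
    (hne : p * s - q * r ≠ 0) : 1 ≤ |p * s - q * r| := by
  have h2 : Real.sqrt 2 * Real.sqrt 2 = 2 := Real.mul_self_sqrt zero_le_two
  obtain ⟨a, c, rfl, rfl⟩ | ⟨a, c, rfl, rfl⟩ := hpq.exists_int <;>
    obtain ⟨a', c', rfl, rfl⟩ | ⟨a', c', rfl, rfl⟩ := hrs.exists_int
  · have e : (a : ℝ) * (Real.sqrt 2 * c') - Real.sqrt 2 * c * a' =
        Real.sqrt 2 * ((a * c' - c * a' : ℤ) : ℝ) := by push_cast; ring
    rw [e] at hne ⊢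
    exact one_le_abs_sqrt_two_mul_intCast hne
  · have e : (a : ℝ) * c' - Real.sqrt 2 * c * (Real.sqrt 2 * a') =
        ((a * c' - 2 * c * a' : ℤ) : ℝ) := by
      push_cast; linear_combination (-(c : ℝ) * a') * h2
    rw [e] at hne ⊢
    exact one_le_abs_intCast hne
  · have e : Real.sqrt 2 * (a : ℝ) * (Real.sqrt 2 * c') - c * a' =
        ((2 * a * c' - c * a' : ℤ) : ℝ) := by
      push_cast; linear_combination ((a : ℝ) * c') * h2
    rw [e] at hne ⊢
    exact one_le_abs_intCast hne
  · have e : Real.sqrt 2 * (a : ℝ) * c' - c * (Real.sqrt 2 * a') =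
        Real.sqrt 2 * ((a * c' - c * a' : ℤ) : ℝ) := by push_cast; ring
    rw [e] at hne ⊢
    exact one_le_abs_sqrt_two_mul_intCast hne

theorem legendre_H4 (α p q : ℝ) (hpq : QH4 p q)
    (h : |α - p / q| < 1 / (2 * q ^ 2)) :
    IsBest α p q := by
  refine ⟨hpq, fun r s hrs hne hsq => ?_⟩
  have hq : 0 < q := hpq.1
  have hs : 0 < s := hrs.1
  have hdet : p * s - q * r ≠ 0 := fun h0 =>
    hne ((div_eq_div_iff hs.ne' hq.ne').mpr (by linarith))
  have hclose : 2 * q * |q * α - p| < 1 := by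
    have e : q * α - p = q * (α - p / q) := by field_simp
    rw [e, abs_mul, abs_of_pos hq]
    rw [lt_div_iff₀ (by positivity)] at h
    linarith
  by_contra! hle
  have hbound : |p * s - q * r| ≤ q * |s * α - r| + s * |q * α - p| := by
    have e : p * s - q * r = q * (s * α - r) - s * (q * α - p) := by ring
    rw [e]
    refine (abs_sub _ _).trans_eq ?_
    rw [abs_mul, abs_mul, abs_of_pos hq, abs_of_pos hs]
  have h1 := mul_le_mul_of_nonneg_left hle hq.le
  have h2 := mul_le_mul_of_nonneg_right hsq (abs_nonneg (q * α - p))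
  linarith [hpq.one_le_abs_det hrs hdet]
end

section
/- There exists a real number α with α ∉ √2·ℚ and a sequence of fractions p_n/q_n ∈ ℚ(H₄), none of which is an H₄-best approximation of α, such that q_n → ∞ and q_n²·|α − p_n/q_n| → 1/2 as n → ∞. In particular, the constant 1/2 in the Legendre-type criterion (|α − p/q| < 1/(2q²) implies p/q is an H₄-best approximation) cannot be replaced by any larger constant. -/
/-- The Pell equation `x ^ 2 = 2 * y ^ 2 + 1` has arbitrarily large solutions. -/
theorem exists_pell_two_ge (n : ℕ) :
    ∃ x y : ℤ, (n : ℤ) + 1 ≤ x ∧ 0 < y ∧ x ^ 2 = 2 * y ^ 2 + 1 := by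
  induction n with
  | zero => exact ⟨3, 2, by norm_num, by norm_num, by norm_num⟩
  | succ n ih =>
    obtain ⟨x, y, hx, hy, h⟩ := ih
    refine ⟨3 * x + 4 * y, 2 * x + 3 * y, ?_, by omega, by linear_combination h⟩
    push_cast
    omega

theorem odd_of_pell_two {x y : ℤ} (h : x ^ 2 = 2 * y ^ 2 + 1) : Odd x := by
  have hx : Odd (x ^ 2) := ⟨y ^ 2, h⟩
  exact (Int.odd_pow' two_ne_zero).mp hx

theorem notSqrt2Rat_one : NotSqrt2Rat 1 := by
  rintro ⟨x, hx⟩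
  refine irrational_sqrt_two ⟨x⁻¹, ?_⟩
  push_cast
  exact (eq_inv_of_mul_eq_one_left hx.symm).symm

theorem QH4_sqrt_two_mul_left {x y : ℤ} (hx : 0 < x) (h : x ^ 2 = 2 * y ^ 2 + 1) :
    QH4 (Real.sqrt 2 * y) x :=
  ⟨by exact_mod_cast hx, -x, Real.sqrt 2 * (-y : ℤ), Or.inl <| Or.inr
    ⟨y, -x, x, -y, (odd_of_pell_two h).neg, odd_of_pell_two h, by linear_combination h,
      rfl, by push_cast; rfl, rfl, rfl⟩⟩

theorem QH4_sqrt_two_mul_right {x y : ℤ} (hy : 0 < y) (h : x ^ 2 = 2 * y ^ 2 + 1) :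
    QH4 x (Real.sqrt 2 * y) :=
  ⟨by positivity, Real.sqrt 2 * y, x, Or.inl <| Or.inl
    ⟨x, y, y, x, odd_of_pell_two h, odd_of_pell_two h, by linear_combination h,
      rfl, rfl, rfl, rfl⟩⟩

theorem sq_eq_sqrt_two_mul_sq_add_one {x y : ℤ} (h : x ^ 2 = 2 * y ^ 2 + 1) :
    (x : ℝ) ^ 2 = (Real.sqrt 2 * y) ^ 2 + 1 := by
  rw [mul_pow, Real.sq_sqrt zero_le_two]
  exact_mod_cast h

theorem sqrt_two_mul_lt {x y : ℤ} (hx : 0 < x) (h : x ^ 2 = 2 * y ^ 2 + 1) :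
    Real.sqrt 2 * y < x :=
  lt_of_pow_lt_pow_left₀ 2 (by exact_mod_cast hx.le)
    (by linarith [sq_eq_sqrt_two_mul_sq_add_one h])

/-- The fractions `√2 y / x` and `x / (√2 y)` approximate `1` equally well, and the second one has
the smaller denominator. -/
theorem not_isBest_one {x y : ℤ} (hx : 0 < x) (hy : 0 < y) (h : x ^ 2 = 2 * y ^ 2 + 1) :
    ¬ IsBest 1 (Real.sqrt 2 * y) x := by
  rintro ⟨-, hbest⟩
  have hlt := sqrt_two_mul_lt hx h
  have hx' : (0 : ℝ) < x := by exact_mod_cast hx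
  have hv : 0 < Real.sqrt 2 * (y : ℝ) := by positivity
  refine absurd (hbest x (Real.sqrt 2 * y) (QH4_sqrt_two_mul_right hy h) ?_ hlt.le) ?_
  · rw [Ne, div_eq_div_iff hv.ne' hx'.ne']
    nlinarith
  · rw [mul_one, mul_one, abs_sub_comm]
    exact lt_irrefl _

theorem abs_sq_mul_abs_one_sub_sub_half_le {x y : ℤ} (hx : 0 < x) (hy : 0 < y)
    (h : x ^ 2 = 2 * y ^ 2 + 1) :
    |(x : ℝ) ^ 2 * |1 - Real.sqrt 2 * (y : ℝ) / (x : ℝ)| - 1 / 2| ≤ 1 / (x : ℝ) := by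
  have hlt := sqrt_two_mul_lt hx h
  have hsq := sq_eq_sqrt_two_mul_sq_add_one h
  have hx' : (1 : ℝ) ≤ x := by exact_mod_cast hx
  have hv : 0 < Real.sqrt 2 * (y : ℝ) := by positivity
  generalize Real.sqrt 2 * (y : ℝ) = v at *
  generalize (x : ℝ) = u at *
  have hu : 0 < u := by linarith
  have habs : |1 - v / u| = 1 - v / u :=
    abs_of_nonneg (sub_nonneg.mpr ((div_le_one hu).mpr hlt.le))
  have hval : u ^ 2 * (1 - v / u) - 1 / 2 = (u - v) ^ 2 / 2 := by
    field_simp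
    linear_combination hsq
  have hdiff : u - v ≤ 1 / u := by
    rw [le_div_iff₀ hu]
    nlinarith
  have hone : 1 / u ≤ 1 := (div_le_one hu).mpr hx'
  rw [habs, hval, abs_of_nonneg (by positivity)]
  nlinarith

theorem legendre_optimal :
    ∃ α : ℝ, NotSqrt2Rat α ∧ ∃ p q : ℕ → ℝ,
      (∀ n : ℕ, QH4 (p n) (q n)) ∧
      (∀ n : ℕ, ¬ IsBest α (p n) (q n)) ∧
      Filter.Tendsto q Filter.atTop Filter.atTop ∧
      Filter.Tendsto (fun n => (q n) ^ 2 * |α - p n / q n|) Filter.atTop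
        (nhds (1 / 2)) := by
  choose x y hx hy h using exists_pell_two_ge
  have hpos : ∀ n, 0 < x n := fun n => by have := hx n; omega
  have hq : Filter.Tendsto (fun n => (x n : ℝ)) Filter.atTop Filter.atTop := by
    refine Filter.tendsto_atTop_mono (fun n => ?_) tendsto_natCast_atTop_atTop
    have := hx n
    exact_mod_cast (by omega : (n : ℤ) ≤ x n)
  refine ⟨1, notSqrt2Rat_one, fun n => Real.sqrt 2 * y n, fun n => x n,
    fun n => QH4_sqrt_two_mul_left (hpos n) (h n),
    fun n => not_isBest_one (hpos n) (hy n) (h n), hq, ?_⟩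
  rw [tendsto_iff_dist_tendsto_zero]
  exact squeeze_zero (fun _ => dist_nonneg)
    (fun n => abs_sq_mul_abs_one_sub_sub_half_le (hpos n) (hy n) (h n))
    (hq.const_div_atTop 1)
end

section
/- Let α > 0 be a real number with α ∉ √2·ℚ, with H₄-expansion data G_n = (t_n, v_n; u_n, w_n), and let n ≥ m(α)+1 (so u_n, w_n > 0). If p/q ∈ ℚ(H₄) and p/q does not lie in the closed interval [v_n/w_n, t_n/u_n], then |q·α − p| > |u_n·α − t_n| and |q·α − p| > |w_n·α − v_n|. -/
/-- The matrices A₁, A₂, A₃ generating the H₄-expansion. -/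
noncomputable def Amat : ℕ → Matrix (Fin 2) (Fin 2) ℝ
  | 1 => !![1, 0; Real.sqrt 2, 1]
  | 2 => !![Real.sqrt 2, 1; 1, Real.sqrt 2]
  | _ => !![1, Real.sqrt 2; 0, 1]

/-- G_n = A_{d₁} ⋯ A_{d_n}. -/
noncomputable def Gmat (d : ℕ → ℕ) (n : ℕ) : Matrix (Fin 2) (Fin 2) ℝ :=
  ((List.range n).map (fun i => Amat (d (i + 1)))).prod

noncomputable def tn (d : ℕ → ℕ) (n : ℕ) : ℝ := Gmat d n 0 0
noncomputable def vn (d : ℕ → ℕ) (n : ℕ) : ℝ := Gmat d n 0 1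
noncomputable def un (d : ℕ → ℕ) (n : ℕ) : ℝ := Gmat d n 1 0
noncomputable def wn (d : ℕ → ℕ) (n : ℕ) : ℝ := Gmat d n 1 1

/-- α_n = G_n⁻¹ · α. -/
noncomputable def alphan (d : ℕ → ℕ) (α : ℝ) (n : ℕ) : ℝ :=
  (wn d n * α - vn d n) / (tn d n - un d n * α)

/-- α*_n = w_n / u_n. -/
noncomputable def alphast (d : ℕ → ℕ) (n : ℕ) : ℝ := wn d n / un d n

/-- The shape of a column of a matrix in `H4`: one entry is an integer, the other an integer
multiple of `√2`. -/
def IsMixedColumn (x y : ℝ) : Prop :=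
  (∃ a c : ℤ, x = a ∧ y = Real.sqrt 2 * c) ∨ (∃ a c : ℤ, x = Real.sqrt 2 * a ∧ y = c)

theorem IsMixedColumn.neg {x y : ℝ} (h : IsMixedColumn x y) : IsMixedColumn (-x) (-y) := by
  rcases h with ⟨a, c, rfl, rfl⟩ | ⟨a, c, rfl, rfl⟩
  · exact Or.inl ⟨-a, -c, by push_cast; ring, by push_cast; ring⟩
  · exact Or.inr ⟨-a, -c, by push_cast; ring, by push_cast; ring⟩

theorem H4form.isMixedColumn {p r q s : ℝ} (h : H4form p r q s) : IsMixedColumn p q := by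
  rcases h with ⟨a, _, c, _, _, _, _, hp, _, hq, _⟩ | ⟨a, _, c, _, _, _, _, hp, _, hq, _⟩
  · exact Or.inl ⟨a, c, hp, hq⟩
  · exact Or.inr ⟨a, c, hp, hq⟩

theorem QH4.isMixedColumn {p q : ℝ} (h : QH4 p q) : IsMixedColumn p q := by
  obtain ⟨-, r, s, h | h⟩ := h
  · exact h.isMixedColumn
  · simpa using h.isMixedColumn.neg

theorem one_le_abs_intCast_s6 {a : ℤ} (h : (a : ℝ) ≠ 0) : 1 ≤ |(a : ℝ)| := by
  exact_mod_cast Int.one_le_abs (by exact_mod_cast h)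

theorem one_le_abs_sqrt_two_mul_intCast_s6 {a : ℤ} (h : Real.sqrt 2 * (a : ℝ) ≠ 0) :
    1 ≤ |Real.sqrt 2 * (a : ℝ)| := by
  rw [abs_mul, abs_of_nonneg (Real.sqrt_nonneg 2)]
  exact one_le_mul_of_one_le_of_one_le (Real.one_le_sqrt.2 one_le_two)
    (one_le_abs_intCast_s6 (right_ne_zero_of_mul h))

theorem IsMixedColumn.one_le_abs {x y : ℝ} (h : IsMixedColumn x y) (hx : x ≠ 0) (hy : y ≠ 0) :
    1 ≤ |x| ∧ 1 ≤ |y| := by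
  rcases h with ⟨a, c, rfl, rfl⟩ | ⟨a, c, rfl, rfl⟩
  · exact ⟨one_le_abs_intCast_s6 hx, one_le_abs_sqrt_two_mul_intCast_s6 hy⟩
  · exact ⟨one_le_abs_sqrt_two_mul_intCast_s6 hx, one_le_abs_intCast_s6 hy⟩

/-- Mixed columns are preserved by `A₁⁻¹`. -/
theorem IsMixedColumn.inv_one {x y : ℝ} (h : IsMixedColumn x y) :
    IsMixedColumn x (y - Real.sqrt 2 * x) := by
  have h2 : Real.sqrt 2 * Real.sqrt 2 = 2 := Real.mul_self_sqrt zero_le_two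
  rcases h with ⟨a, c, rfl, rfl⟩ | ⟨a, c, rfl, rfl⟩
  · exact Or.inl ⟨a, c - a, rfl, by push_cast; ring⟩
  · exact Or.inr ⟨a, c - 2 * a, rfl, by push_cast; linear_combination (-(a : ℝ)) * h2⟩

theorem IsMixedColumn.swap {x y : ℝ} (h : IsMixedColumn x y) : IsMixedColumn y x := by
  rcases h with ⟨a, c, hx, hy⟩ | ⟨a, c, hx, hy⟩
  · exact Or.inr ⟨c, a, hy, hx⟩
  · exact Or.inl ⟨c, a, hy, hx⟩

/-- Mixed columns are preserved by `A₃⁻¹`. -/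
theorem IsMixedColumn.inv_three {x y : ℝ} (h : IsMixedColumn x y) :
    IsMixedColumn (x - Real.sqrt 2 * y) y :=
  h.swap.inv_one.swap

/-- Mixed columns are preserved by `A₂⁻¹`. -/
theorem IsMixedColumn.inv_two {x y : ℝ} (h : IsMixedColumn x y) :
    IsMixedColumn (Real.sqrt 2 * x - y) (Real.sqrt 2 * y - x) := by
  have h2 : Real.sqrt 2 * Real.sqrt 2 = 2 := Real.mul_self_sqrt zero_le_two
  rcases h with ⟨a, c, rfl, rfl⟩ | ⟨a, c, rfl, rfl⟩
  · exact Or.inr ⟨a - c, 2 * c - a, by push_cast; ring, by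
      push_cast; linear_combination (c : ℝ) * h2⟩
  · exact Or.inl ⟨2 * a - c, c - a, by push_cast; linear_combination (a : ℝ) * h2, by
      push_cast; ring⟩

theorem Gmat_zero (d : ℕ → ℕ) : Gmat d 0 = 1 := by simp [Gmat]

theorem Gmat_succ (d : ℕ → ℕ) (n : ℕ) : Gmat d (n + 1) = Gmat d n * Amat (d (n + 1)) := by
  simp [Gmat, List.range_succ]

section Step

variable {d : ℕ → ℕ} {n : ℕ}

theorem entries_succ_of_eq_one (h : d (n + 1) = 1) :
    tn d (n + 1) = tn d n + Real.sqrt 2 * vn d n ∧ vn d (n + 1) = vn d n ∧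
      un d (n + 1) = un d n + Real.sqrt 2 * wn d n ∧ wn d (n + 1) = wn d n := by
  simp [tn, vn, un, wn, Gmat_succ, h, Amat, Matrix.mul_apply, Fin.sum_univ_two, mul_comm]

theorem entries_succ_of_eq_two (h : d (n + 1) = 2) :
    tn d (n + 1) = Real.sqrt 2 * tn d n + vn d n ∧ vn d (n + 1) = tn d n + Real.sqrt 2 * vn d n ∧
      un d (n + 1) = Real.sqrt 2 * un d n + wn d n ∧
      wn d (n + 1) = un d n + Real.sqrt 2 * wn d n := by
  simp [tn, vn, un, wn, Gmat_succ, h, Amat, Matrix.mul_apply, Fin.sum_univ_two, mul_comm]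

theorem entries_succ_of_eq_three (h : d (n + 1) = 3) :
    tn d (n + 1) = tn d n ∧ vn d (n + 1) = Real.sqrt 2 * tn d n + vn d n ∧
      un d (n + 1) = un d n ∧ wn d (n + 1) = Real.sqrt 2 * un d n + wn d n := by
  simp [tn, vn, un, wn, Gmat_succ, h, Amat, Matrix.mul_apply, Fin.sum_univ_two, mul_comm]

end Step

theorem det_entries {d : ℕ → ℕ}
    (hd : ∀ n : ℕ, 1 ≤ n → d n = 1 ∨ d n = 2 ∨ d n = 3) (n : ℕ) :
    tn d n * wn d n - vn d n * un d n = 1 := by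
  have h2 : Real.sqrt 2 * Real.sqrt 2 = 2 := Real.mul_self_sqrt zero_le_two
  induction n with
  | zero => simp [tn, vn, un, wn, Gmat_zero]
  | succ n ih =>
    rcases hd (n + 1) n.succ_pos with h | h | h
    · obtain ⟨ht, hv, hu, hw⟩ := entries_succ_of_eq_one h
      rw [ht, hv, hu, hw]; linear_combination ih
    · obtain ⟨ht, hv, hu, hw⟩ := entries_succ_of_eq_two h
      rw [ht, hv, hu, hw]
      linear_combination (tn d n * wn d n - vn d n * un d n) * h2 + ih
    · obtain ⟨ht, hv, hu, hw⟩ := entries_succ_of_eq_three h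
      rw [ht, hv, hu, hw]; linear_combination ih

theorem un_nonneg_wn_pos {d : ℕ → ℕ}
    (hd : ∀ n : ℕ, 1 ≤ n → d n = 1 ∨ d n = 2 ∨ d n = 3) (n : ℕ) :
    0 ≤ un d n ∧ 0 < wn d n := by
  induction n with
  | zero => simp [un, wn, Gmat_zero]
  | succ n ih =>
    obtain ⟨hu0, hw0⟩ := ih
    rcases hd (n + 1) n.succ_pos with h | h | h
    · obtain ⟨-, -, hu, hw⟩ := entries_succ_of_eq_one h
      rw [hu, hw]; constructor <;> positivity
    · obtain ⟨-, -, hu, hw⟩ := entries_succ_of_eq_two h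
      rw [hu, hw]; constructor <;> positivity
    · obtain ⟨-, -, hu, hw⟩ := entries_succ_of_eq_three h
      rw [hu, hw]; constructor <;> positivity

theorem un_pos_of_ne_three {d : ℕ → ℕ}
    (hd : ∀ n : ℕ, 1 ≤ n → d n = 1 ∨ d n = 2 ∨ d n = 3)
    {m n : ℕ} (hm : d (m + 1) ≠ 3) (hn : m + 1 ≤ n) : 0 < un d n := by
  induction n, hn using Nat.le_induction with
  | base =>
    obtain ⟨hu0, hw0⟩ := un_nonneg_wn_pos hd m
    rcases hd (m + 1) m.succ_pos with h | h | h
    · rw [(entries_succ_of_eq_one h).2.2.1]; positivity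
    · rw [(entries_succ_of_eq_two h).2.2.1]; positivity
    · exact absurd h hm
  | succ n _ ih =>
    have hw0 := (un_nonneg_wn_pos hd n).2
    rcases hd (n + 1) n.succ_pos with h | h | h
    · rw [(entries_succ_of_eq_one h).2.2.1]; positivity
    · rw [(entries_succ_of_eq_two h).2.2.1]; positivity
    · rwa [(entries_succ_of_eq_three h).2.2.1]

/-- Mixed columns are preserved by `G_n⁻¹`. -/
theorem IsMixedColumn.Gmat_inv {d : ℕ → ℕ}
    (hd : ∀ n : ℕ, 1 ≤ n → d n = 1 ∨ d n = 2 ∨ d n = 3)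
    {p q : ℝ} (hpq : IsMixedColumn p q) (n : ℕ) :
    IsMixedColumn (wn d n * p - vn d n * q) (tn d n * q - un d n * p) := by
  induction n with
  | zero => simpa [tn, vn, un, wn, Gmat_zero] using hpq
  | succ n ih =>
    rcases hd (n + 1) n.succ_pos with h | h | h
    · obtain ⟨ht, hv, hu, hw⟩ := entries_succ_of_eq_one h
      convert ih.inv_one using 1
      · rw [hv, hw]
      · rw [ht, hu]; ring
    · obtain ⟨ht, hv, hu, hw⟩ := entries_succ_of_eq_two h
      convert ih.inv_two using 1
      · rw [hv, hw]; ring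
      · rw [ht, hu]; ring
    · obtain ⟨ht, hv, hu, hw⟩ := entries_succ_of_eq_three h
      convert ih.inv_three using 1
      · rw [hv, hw]; ring
      · rw [ht, hu]

/-- If `x` and `y` have opposite signs and absolute values at least `1`, and `a < 0 < b`, then
`|x * a + y * b|` exceeds both `|a|` and `|b|`. -/
theorem abs_lt_abs_mul_add_mul {a b x y : ℝ} (ha : a < 0) (hb : 0 < b) (hxy : x * y < 0)
    (hx : 1 ≤ |x|) (hy : 1 ≤ |y|) :
    |a| < |x * a + y * b| ∧ |b| < |x * a + y * b| := by
  have key : |x * a + y * b| = |x| * |a| + |y| * |b| := by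
    rw [← abs_mul, ← abs_mul]
    refine abs_add_eq_add_abs_iff _ _ |>.2 ?_
    rcases mul_neg_iff.1 hxy with ⟨h1, h2⟩ | ⟨h1, h2⟩
    · exact Or.inr ⟨(mul_neg_of_pos_of_neg h1 ha).le, (mul_neg_of_neg_of_pos h2 hb).le⟩
    · exact Or.inl ⟨(mul_pos_of_neg_of_neg h1 ha).le, (mul_pos h2 hb).le⟩
  have ha' : 0 < |a| := abs_pos.2 ha.ne
  have hb' : 0 < |b| := abs_pos.2 hb.ne'
  rw [key]
  constructor <;> nlinarith

theorem outside_interval (α : ℝ) (hα : 0 < α) (hirr : NotSqrt2Rat α)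
    (d : ℕ → ℕ)
    (hd : ∀ n : ℕ, 1 ≤ n → d n = 1 ∨ d n = 2 ∨ d n = 3)
    (hmem : ∀ n : ℕ, 1 ≤ n → vn d n < wn d n * α ∧ un d n * α < tn d n)
    (m : ℕ) (hm : ∀ n : ℕ, 1 ≤ n → n ≤ m → d n = 3) (hm1 : d (m + 1) ≠ 3)
    (n : ℕ) (hn : m + 1 ≤ n)
    (p q : ℝ) (hpq : QH4 p q)
    (hout : p / q ∉ Set.Icc (vn d n / wn d n) (tn d n / un d n)) :
    |un d n * α - tn d n| < |q * α - p| ∧ |wn d n * α - vn d n| < |q * α - p| := by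
  obtain ⟨hv, hu⟩ := hmem n (by omega)
  have hw0 : 0 < wn d n := (un_nonneg_wn_pos hd n).2
  have hu0 : 0 < un d n := un_pos_of_ne_three hd hm1 hn
  have hdet := det_entries hd n
  have hq : 0 < q := hpq.1
  have hcol := hpq.isMixedColumn.Gmat_inv hd n
  set x := wn d n * p - vn d n * q with hx
  set y := tn d n * q - un d n * p with hy
  have hqxy : q = un d n * x + wn d n * y := by
    rw [hx, hy]; linear_combination (-q) * hdet
  have hxy : x * y < 0 := by
    rw [Set.mem_Icc, not_and_or, not_le, not_le, div_lt_div_iff₀ hq hw0,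
      div_lt_div_iff₀ hu0 hq] at hout
    rcases hout with h | h
    · have hx0 : x < 0 := by rw [hx]; linarith
      exact mul_neg_of_neg_of_pos hx0 (by
        by_contra! hy0
        nlinarith [mul_pos_of_neg_of_neg hx0 (neg_neg_of_pos hu0)])
    · have hy0 : y < 0 := by rw [hy]; linarith
      exact mul_neg_of_pos_of_neg (by
        by_contra! hx0
        nlinarith [mul_pos_of_neg_of_neg hy0 (neg_neg_of_pos hw0)]) hy0
  have hdecomp : q * α - p = x * (un d n * α - tn d n) + y * (wn d n * α - vn d n) := by
    rw [hx, hy]; linear_combination (p - q * α) * hdet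
  have hne : x ≠ 0 ∧ y ≠ 0 := mul_ne_zero_iff.1 hxy.ne
  obtain ⟨hx1, hy1⟩ := hcol.one_le_abs hne.1 hne.2
  rw [hdecomp]
  exact abs_lt_abs_mul_add_mul (sub_neg.2 hu) (sub_pos.2 hv) hxy hx1 hy1
end

section
/- Let α > 0 be a real number with α ∉ √2·ℚ, and let (p_i/q_i)_{i≥1} be an enumeration of all H₄-best approximations of α such that q_i is strictly increasing (i.e., each p_i/q_i is an H₄-best approximation of α, q_i < q_{i+1} for all i, and every H₄-best approximation of α equals p_i/q_i for some i). Then K(α) = limsup_{i→∞} q_{i+1}·|q_i·α − p_i|. -/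
/-- The set of uniform approximation constants K admissible for α. -/
def Kset (α : ℝ) : Set ℝ :=
  {K : ℝ | 0 < K ∧ ∃ N₀ : ℝ, ∀ N : ℝ, N₀ ≤ N →
    ∃ p q : ℝ, QH4 p q ∧ |q * α - p| < K / N ∧ 1 ≤ q ∧ q ≤ N}

/-- The uniform approximation constant K(α). -/
noncomputable def Kconst (α : ℝ) : ℝ := sInf (Kset α)

/-- Integral description of `QH4`: numerator and denominator are coprime integers, one of
them multiplied by `√2`, the other one odd. -/
theorem QH4.cases {p q : ℝ} (h : QH4 p q) :
    (∃ a c : ℤ, 0 < c ∧ IsCoprime a (2 * c) ∧ p = a ∧ q = Real.sqrt 2 * c) ∨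
    (∃ a c : ℤ, 0 < c ∧ IsCoprime (2 * a) c ∧ p = Real.sqrt 2 * a ∧ q = c) := by
  have h2 : (0 : ℝ) < Real.sqrt 2 := by positivity
  obtain ⟨hq, r, s, h⟩ := h
  rcases h with (⟨a, b, c, d, -, -, hdet, hp, -, hq', -⟩ | ⟨a, b, c, d, -, -, hdet, hp, -, hq', -⟩) |
    (⟨a, b, c, d, -, -, hdet, hp, -, hq', -⟩ | ⟨a, b, c, d, -, -, hdet, hp, -, hq', -⟩)
  · refine Or.inl ⟨a, c, ?_, ⟨d, -b, by linarith⟩, hp, hq'⟩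
    rw [hq'] at hq
    exact_mod_cast pos_of_mul_pos_right hq h2.le
  · refine Or.inr ⟨a, c, ?_, ⟨d, -b, by linarith⟩, hp, hq'⟩
    rw [hq'] at hq
    exact_mod_cast hq
  · refine Or.inl ⟨-a, -c, ?_, ⟨-d, b, by linarith⟩, by push_cast; linarith,
      by push_cast; linarith⟩
    have : 0 < Real.sqrt 2 * ((-c : ℤ) : ℝ) := by push_cast; linarith
    exact_mod_cast pos_of_mul_pos_right this h2.le
  · refine Or.inr ⟨-a, -c, ?_, ⟨-d, b, by linarith⟩, by push_cast; linarith,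
      by push_cast; linarith⟩
    have : 0 < ((-c : ℤ) : ℝ) := by push_cast; linarith
    exact_mod_cast this

/-- Reduced fractions of integers with positive denominators are unique. -/
theorem eq_and_eq_of_isCoprime_of_mul_eq {a c a' c' : ℤ} (hc : 0 < c) (hc' : 0 < c')
    (h : IsCoprime a c) (h' : IsCoprime a' c') (he : a * c' = a' * c) : a = a' ∧ c = c' := by
  have h1 : c ∣ c' := h.symm.dvd_of_dvd_mul_left ⟨a', by linarith⟩
  have h2 : c' ∣ c := h'.symm.dvd_of_dvd_mul_left ⟨a, by linarith⟩
  have h3 : c = c' := Int.dvd_antisymm hc.le hc'.le h1 h2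
  subst h3
  exact ⟨mul_right_cancel₀ hc.ne' he, rfl⟩

theorem QH4.eq_of_div_eq {p q r s : ℝ} (h : QH4 p q) (h' : QH4 r s) (he : p / q = r / s) :
    p = r ∧ q = s := by
  have h2 : Real.sqrt 2 ≠ 0 := by positivity
  have hsq : Real.sqrt 2 * Real.sqrt 2 = 2 := Real.mul_self_sqrt (by norm_num)
  rw [div_eq_div_iff h.1.ne' h'.1.ne'] at he
  rcases h.cases with ⟨a, c, hc, hco, rfl, rfl⟩ | ⟨a, c, hc, hco, rfl, rfl⟩ <;>
  rcases h'.cases with ⟨a', c', hc', hco', rfl, rfl⟩ | ⟨a', c', hc', hco', rfl, rfl⟩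
  · have : (a : ℝ) * c' = a' * c := mul_left_cancel₀ h2 (by linarith)
    obtain ⟨rfl, rfl⟩ := eq_and_eq_of_isCoprime_of_mul_eq hc hc' hco.of_mul_right_right
      hco'.of_mul_right_right (by exact_mod_cast this)
    exact ⟨rfl, rfl⟩
  · exfalso
    have : (a : ℝ) * c' = 2 * (a' * c) := by linear_combination he + a' * c * hsq
    have h3 : a * c' = 2 * (a' * c) := by exact_mod_cast this
    have ha : IsCoprime 2 a := hco.of_mul_right_left.symm
    have hcc : IsCoprime 2 c' := hco'.of_mul_left_left
    have := (ha.mul_right hcc).isUnit_of_dvd' dvd_rfl ⟨_, h3⟩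
    exact absurd this (by decide)
  · exfalso
    have : (a' : ℝ) * c = 2 * (a * c') := by linear_combination -he + a * c' * hsq
    have h3 : a' * c = 2 * (a * c') := by exact_mod_cast this
    have ha : IsCoprime 2 a' := hco'.of_mul_right_left.symm
    have hcc : IsCoprime 2 c := hco.of_mul_left_left
    have := (ha.mul_right hcc).isUnit_of_dvd' dvd_rfl ⟨_, h3⟩
    exact absurd this (by decide)
  · have : (a : ℝ) * c' = a' * c := mul_left_cancel₀ h2 (by linarith)
    obtain ⟨rfl, rfl⟩ := eq_and_eq_of_isCoprime_of_mul_eq hc hc' hco.of_mul_left_right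
      hco'.of_mul_left_right (by exact_mod_cast this)
    exact ⟨rfl, rfl⟩

theorem QH4.exists_sq_eq_natCast {p q : ℝ} (h : QH4 p q) : ∃ n : ℕ, 0 < n ∧ q ^ 2 = n := by
  have hsq : Real.sqrt 2 ^ 2 = 2 := Real.sq_sqrt (by norm_num)
  rcases h.cases with ⟨a, c, hc, hco, rfl, rfl⟩ | ⟨a, c, hc, hco, rfl, rfl⟩
  · lift c to ℕ using hc.le
    refine ⟨2 * c ^ 2, ?_, ?_⟩
    · have : 0 < c := by exact_mod_cast hc
      positivity
    · rw [mul_pow, hsq]; push_cast; ring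
  · lift c to ℕ using hc.le
    refine ⟨c ^ 2, ?_, by push_cast; ring⟩
    have : 0 < c := by exact_mod_cast hc
    positivity

theorem QH4.one_le {p q : ℝ} (h : QH4 p q) : 1 ≤ q := by
  obtain ⟨n, hn, hq⟩ := h.exists_sq_eq_natCast
  have : (1 : ℝ) ≤ n := by exact_mod_cast hn
  nlinarith [h.1]

theorem QH4.eq_of_abs_eq {α p q r : ℝ} (hirr : NotSqrt2Rat α) (h : QH4 p q) (h' : QH4 r q)
    (he : |q * α - p| = |q * α - r|) : p = r := by
  have h2 : Real.sqrt 2 ≠ 0 := by positivity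
  have hsq : Real.sqrt 2 * Real.sqrt 2 = 2 := Real.mul_self_sqrt (by norm_num)
  have key : ∀ a c : ℤ, 0 < c → Real.sqrt 2 * c ≠ a := by
    intro a c hc hac
    refine irrational_sqrt_two ⟨(a : ℚ) / c, ?_⟩
    have : (c : ℝ) ≠ 0 := by exact_mod_cast hc.ne'
    push_cast
    field_simp
    linarith
  rcases abs_eq_abs.1 he with he | he
  · linarith
  exfalso
  have hq := h.1.ne'
  have hα : α = (p + r) / (2 * q) := by
    field_simp
    linarith
  apply hirr
  rcases h.cases with ⟨a, c, hc, -, hp, hq'⟩ | ⟨a, c, hc, -, hp, hq'⟩ <;>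
  rcases h'.cases with ⟨b, d, hd, -, hr, hq''⟩ | ⟨b, d, hd, -, hr, hq''⟩
  · refine ⟨(a + b) / (4 * c), ?_⟩
    have : (c : ℝ) ≠ 0 := by exact_mod_cast hc.ne'
    rw [hα, hp, hr, hq']
    push_cast
    field_simp
    linear_combination -2 * ((a : ℝ) + b) * hsq
  · exact absurd (hq'.symm.trans hq'') (key _ _ hc)
  · exact absurd (hq''.symm.trans hq') (key _ _ hd)
  · refine ⟨(a + b) / (2 * c), ?_⟩
    have : (c : ℝ) ≠ 0 := by exact_mod_cast hc.ne'
    rw [hα, hp, hr, hq']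
    push_cast
    field_simp

theorem finite_abs_mul_intCast_le (t B : ℝ) (ht : 1 ≤ t) :
    {x : ℝ | |x| ≤ B ∧ ∃ a : ℤ, x = t * a}.Finite := by
  refine ((Set.finite_Icc (-⌈B⌉) ⌈B⌉).image fun a : ℤ => t * (a : ℝ)).subset ?_
  rintro _ ⟨hx, a, rfl⟩
  refine ⟨a, ?_, rfl⟩
  rw [abs_mul, abs_of_pos (by linarith)] at hx
  have h1 : |(a : ℝ)| ≤ ⌈B⌉ := by
    nlinarith [Int.le_ceil B, abs_nonneg (a : ℝ)]
  rw [abs_le] at h1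
  exact ⟨by exact_mod_cast h1.1, by exact_mod_cast h1.2⟩

theorem finite_QH4_le (α N E : ℝ) :
    {x : ℝ × ℝ | QH4 x.1 x.2 ∧ x.2 ≤ N ∧ |x.2 * α - x.1| ≤ E}.Finite := by
  set B := N + N * |α| + E with hB
  have h1 := finite_abs_mul_intCast_le 1 B le_rfl
  have h2 := finite_abs_mul_intCast_le (Real.sqrt 2) B
    (Real.one_le_sqrt.2 (by norm_num))
  refine ((h1.union h2).prod (h1.union h2)).subset ?_
  rintro ⟨r, s⟩ ⟨h, hs, he⟩
  simp only at h hs he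
  have hs0 := h.1
  have hE : 0 ≤ E := (abs_nonneg _).trans he
  have hsα : s * |α| ≤ N * |α| := mul_le_mul_of_nonneg_right hs (abs_nonneg _)
  have hNα : 0 ≤ s * |α| := by positivity
  have hsB : |s| ≤ B := by rw [abs_of_pos hs0]; linarith
  have hrB : |r| ≤ B := by
    have := abs_sub_abs_le_abs_sub r (s * α)
    rw [abs_sub_comm, abs_mul, abs_of_pos hs0] at this
    linarith
  rcases h.cases with ⟨a, c, -, -, hr, hs⟩ | ⟨a, c, -, -, hr, hs⟩
  · exact ⟨Or.inl ⟨hrB, a, by simpa using hr⟩, Or.inr ⟨hsB, c, hs⟩⟩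
  · exact ⟨Or.inr ⟨hrB, a, hr⟩, Or.inl ⟨hsB, c, by simpa using hs⟩⟩

theorem exists_isBest_le {α : ℝ} (hirr : NotSqrt2Rat α) {r s : ℝ} (h : QH4 r s) :
    ∃ p q, IsBest α p q ∧ q ≤ s ∧ |q * α - p| ≤ |s * α - r| := by
  obtain ⟨⟨p, q⟩, ⟨hpq, hqs, hle⟩, hmin⟩ := Set.exists_min_image _
    (fun x : ℝ × ℝ => toLex (|x.2 * α - x.1|, x.2)) (finite_QH4_le α s |s * α - r|)
    ⟨(r, s), h, le_rfl, le_rfl⟩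
  simp only at hpq hqs hle
  refine ⟨p, q, ⟨hpq, ?_⟩, hqs, hle⟩
  intro u v huv hne hvq
  by_contra! hcon
  have := hmin (u, v) ⟨huv, hvq.trans hqs, hcon.trans hle⟩
  rcases Prod.Lex.toLex_le_toLex.1 this with hlt | ⟨heq, hqv⟩
  · exact absurd hlt hcon.not_gt
  · simp only at heq hqv
    obtain rfl : v = q := le_antisymm hvq hqv
    exact hne (by rw [hpq.eq_of_abs_eq hirr huv heq])

theorem Kset_eq (α : ℝ) (hirr : NotSqrt2Rat α) (p q : ℕ → ℝ)
    (hbest : ∀ i : ℕ, IsBest α (p i) (q i))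
    (hmono : ∀ i : ℕ, q i < q (i + 1))
    (hall : ∀ r s : ℝ, IsBest α r s → ∃ i : ℕ, r / s = p i / q i) :
    Kset α = {K | ∀ᶠ i in Filter.atTop, q (i + 1) * |q i * α - p i| ≤ K} := by
  have hQ : ∀ i, QH4 (p i) (q i) := fun i => (hbest i).1
  have hqmono : StrictMono q := strictMono_nat_of_lt_succ hmono
  have hanti : StrictAnti fun i => |q i * α - p i| := by
    refine strictAnti_nat_of_succ_lt fun i => ?_
    refine (hbest (i + 1)).2 _ _ (hQ i) (fun he => ?_) (hmono i).le
    exact (hmono i).ne ((hQ i).eq_of_div_eq (hQ (i + 1)) he).2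
  have hpos : ∀ i, 0 < |q i * α - p i| := fun i =>
    (abs_nonneg _).trans_lt (hanti (Nat.lt_succ_self i))
  have happrox : ∀ r s, QH4 r s → ∃ j, q j ≤ s ∧ |q j * α - p j| ≤ |s * α - r| := by
    intro r s h
    obtain ⟨u, v, hb, hle, herr⟩ := exists_isBest_le hirr h
    obtain ⟨j, hj⟩ := hall u v hb
    obtain ⟨rfl, rfl⟩ := hb.1.eq_of_div_eq (hQ j) hj
    exact ⟨j, hle, herr⟩
  have hsq : ∀ i : ℕ, (i : ℝ) ≤ q i ^ 2 := by
    intro i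
    induction i with
    | zero => simpa using sq_nonneg (q 0)
    | succ i ih =>
      obtain ⟨m, -, hm⟩ := (hQ i).exists_sq_eq_natCast
      obtain ⟨n, -, hn⟩ := (hQ (i + 1)).exists_sq_eq_natCast
      have hlt : q i ^ 2 < q (i + 1) ^ 2 := pow_lt_pow_left₀ (hmono i) (hQ i).1.le two_ne_zero
      rw [hm, hn] at hlt
      rw [hm] at ih
      rw [hn]
      have h1 : i ≤ m := by exact_mod_cast ih
      have h2 : m < n := by exact_mod_cast hlt
      exact_mod_cast (by omega : i + 1 ≤ n)
  have hunb : ∀ N : ℝ, ∃ i, N < q i := by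
    intro N
    obtain ⟨i, hi⟩ := exists_nat_gt (N ^ 2)
    exact ⟨i, lt_of_pow_lt_pow_left₀ 2 (hQ i).1.le (hi.trans_le (hsq i))⟩
  ext K
  simp only [Kset, Set.mem_ofPred_eq, Filter.eventually_atTop]
  constructor
  · rintro ⟨hK, N₀, hN⟩
    obtain ⟨i₀, hi₀⟩ := hunb N₀
    refine ⟨i₀, fun i hi => ?_⟩
    by_contra! hcon
    obtain ⟨r, s, hrs, herr, -, hsN⟩ := hN (max (q i) (K / |q i * α - p i|))
      ((hi₀.le.trans (hqmono.monotone hi)).trans (le_max_left _ _))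
    have hlt : max (q i) (K / |q i * α - p i|) < q (i + 1) :=
      max_lt (hmono i) ((div_lt_iff₀ (hpos i)).2 hcon)
    obtain ⟨j, hj, hje⟩ := happrox r s hrs
    have hji : j ≤ i := Nat.lt_succ_iff.1 (hqmono.lt_iff_lt.1 ((hj.trans hsN).trans_lt hlt))
    have hij := hanti.antitone hji
    have hNpos : 0 < max (q i) (K / |q i * α - p i|) := lt_max_of_lt_left (hQ i).1
    have h1 := (hij.trans hje).trans_lt herr
    rw [lt_div_iff₀ hNpos] at h1
    have h2 := (div_le_iff₀ (hpos i)).1 (le_max_right (q i) (K / |q i * α - p i|))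
    linarith
  · rintro ⟨i₀, hi₀⟩
    refine ⟨(mul_pos (hQ _).1 (hpos i₀)).trans_le (hi₀ i₀ le_rfl), q i₀, fun N hN => ?_⟩
    classical
    have hex : ∃ i, N < q i := hunb N
    obtain ⟨i, hi⟩ : ∃ i, Nat.find hex = i + 1 := by
      refine Nat.exists_eq_succ_of_ne_zero fun h0 => ?_
      have := Nat.find_spec hex
      rw [h0] at this
      exact absurd ((hqmono.monotone (Nat.zero_le i₀)).trans hN) this.not_ge
    have hNi : N < q (i + 1) := hi ▸ Nat.find_spec hex
    have hiN : q i ≤ N := not_lt.1 (Nat.find_min hex (by omega))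
    have hii : i₀ ≤ i := Nat.lt_succ_iff.1 (hqmono.lt_iff_lt.1 (hN.trans_lt hNi))
    refine ⟨p i, q i, hQ i, ?_, (hQ i).one_le, hiN⟩
    rw [lt_div_iff₀ ((hQ i).1.trans_le hiN), mul_comm]
    exact (mul_lt_mul_of_pos_right hNi (hpos i)).trans_le (hi₀ i hii)

theorem K_eq_limsup (α : ℝ) (hα : 0 < α) (hirr : NotSqrt2Rat α)
    (p q : ℕ → ℝ)
    (hbest : ∀ i : ℕ, IsBest α (p i) (q i))
    (hmono : ∀ i : ℕ, q i < q (i + 1))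
    (hall : ∀ r s : ℝ, IsBest α r s → ∃ i : ℕ, r / s = p i / q i) :
    Kconst α = Filter.limsup (fun i => q (i + 1) * |q i * α - p i|) Filter.atTop := by
  rw [Kconst, Kset_eq α hirr p q hbest hmono hall, Filter.limsup_eq]
end

section
/- For α = 1 one has K(1) = (√2 + 1)/2. In particular, the constant (√2 + 1)/2 in the uniform approximation theorem for H₄ cannot be replaced by any smaller constant. -/
theorem sqrt_two_add_one_mul_sqrt_two_sub_one :
    (Real.sqrt 2 + 1) * (Real.sqrt 2 - 1) = 1 := by
  nlinarith [Real.sq_sqrt (show (0 : ℝ) ≤ 2 by norm_num)]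

theorem one_lt_sqrt_two : 1 < Real.sqrt 2 := by
  rw [Real.lt_sqrt] <;> norm_num

theorem sqrt_two_lt : Real.sqrt 2 < 3 / 2 := by
  rw [Real.sqrt_lt'] <;> norm_num

/-- The coordinates of the powers of the fundamental unit `1 + √2` of `ℤ[√2]`. -/
theorem exists_coords_unit_pow (n : ℕ) : ∃ x y : ℤ, Odd x ∧ x ^ 2 - 2 * y ^ 2 = (-1) ^ n ∧
    (x : ℝ) + Real.sqrt 2 * y = (Real.sqrt 2 + 1) ^ n ∧
    (x : ℝ) - Real.sqrt 2 * y = (-1) ^ n * (Real.sqrt 2 - 1) ^ n := by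
  induction n with
  | zero => exact ⟨1, 0, by decide, by norm_num, by simp, by simp⟩
  | succ n ih =>
    obtain ⟨x, y, hx, hn, hu, hv⟩ := ih
    have h2 := Real.sq_sqrt (show (0 : ℝ) ≤ 2 by norm_num)
    refine ⟨x + 2 * y, x + y, hx.add_even (even_two_mul y), ?_, ?_, ?_⟩
    · rw [pow_succ (-1), ← hn]; ring
    · rw [pow_succ, ← hu]; push_cast; linear_combination -(y : ℝ) * h2
    · rw [pow_succ, pow_succ, mul_mul_mul_comm, ← hv]
      push_cast; linear_combination -(y : ℝ) * h2

/-- Division by a power of the fundamental unit preserves `ℤ[√2]`. -/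
theorem exists_coords_div_unit_pow (x y : ℤ) (n : ℕ) : ∃ s t : ℤ,
    ((x : ℝ) + Real.sqrt 2 * y) * (Real.sqrt 2 - 1) ^ n = s + Real.sqrt 2 * t ∧
    |(x : ℝ) - Real.sqrt 2 * y| * (Real.sqrt 2 + 1) ^ n = |(s : ℝ) - Real.sqrt 2 * t| := by
  induction n with
  | zero => exact ⟨x, y, by simp, by simp⟩
  | succ n ih =>
    obtain ⟨s, t, hu, hv⟩ := ih
    have h2 := Real.sq_sqrt (show (0 : ℝ) ≤ 2 by norm_num)
    refine ⟨2 * t - s, s - t, ?_, ?_⟩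
    · rw [pow_succ, ← mul_assoc, hu]; push_cast; linear_combination (t : ℝ) * h2
    · have h0 : 0 ≤ Real.sqrt 2 + 1 := by positivity
      rw [pow_succ, ← mul_assoc, hv]
      nth_rewrite 1 [← abs_of_nonneg h0]
      rw [← abs_mul, ← abs_neg]
      congr 1
      push_cast; linear_combination (t : ℝ) * h2

/-- The fundamental unit is extremal among the `s + t√2 > 0` whose conjugate is less than `1`. -/
theorem eq_one_or_le_of_abs_conj_lt_one {s t : ℤ} (hpos : 0 < (s : ℝ) + Real.sqrt 2 * t)
    (hlt : |(s : ℝ) - Real.sqrt 2 * t| < 1) :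
    (s = 1 ∧ t = 1) ∨ Real.sqrt 2 + 2 ≤ (s : ℝ) + Real.sqrt 2 * t := by
  have h1 := one_lt_sqrt_two
  obtain ⟨hl, hr⟩ := abs_lt.mp hlt
  have ht : 1 ≤ t := by
    by_contra! ht
    rcases (show t ≤ -1 ∨ t = 0 by omega) with ht | rfl
    · have : (t : ℝ) ≤ -1 := by exact_mod_cast ht
      nlinarith
    · simp only [Int.cast_zero, mul_zero, add_zero, sub_zero] at *
      have h3 : 0 < s := by exact_mod_cast hpos
      have h4 : s < 1 := by exact_mod_cast hr
      omega
  have ht' : (1 : ℝ) ≤ t := by exact_mod_cast ht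
  have hs : 1 ≤ s := by
    have : (0 : ℝ) < s := by nlinarith
    exact_mod_cast this
  have hs' : (1 : ℝ) ≤ s := by exact_mod_cast hs
  by_cases hst : s = 1 ∧ t = 1
  · exact Or.inl hst
  · right
    rcases (show 2 ≤ s ∨ 2 ≤ t by omega) with h | h
    · have : (2 : ℝ) ≤ s := by exact_mod_cast h
      nlinarith
    · have : (2 : ℝ) ≤ t := by exact_mod_cast h
      nlinarith

/-- Elements of `ℚ(H₄)` come from elements of `ℤ[√2]`. -/
theorem QH4.exists_coords {p q : ℝ} (h : QH4 p q) : ∃ x y : ℤ,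
    p + q = x + Real.sqrt 2 * y ∧ |q - p| = |(x : ℝ) - Real.sqrt 2 * y| := by
  obtain ⟨-, r, s, h | h⟩ := h <;>
  rcases h with ⟨a, b, c, d, -, -, -, hp, -, hq, -⟩ | ⟨a, b, c, d, -, -, -, hp, -, hq, -⟩
  · exact ⟨a, c, by rw [hp, hq], by rw [hp, hq, abs_sub_comm]⟩
  · exact ⟨c, a, by rw [hp, hq, add_comm], by rw [hp, hq]⟩
  · refine ⟨-a, -c, by push_cast; linarith, ?_⟩
    rw [abs_sub_comm]; congr 1; push_cast; linarith
  · exact ⟨-c, -a, by push_cast; linarith, by congr 1; push_cast; linarith⟩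

/-- The optimal approximations of `1` by elements of `ℚ(H₄)`. -/
theorem QH4_unit_pow {n : ℕ}
    (hpos : 0 < ((Real.sqrt 2 + 1) ^ n - (Real.sqrt 2 - 1) ^ n) / 2) :
    QH4 (((Real.sqrt 2 + 1) ^ n + (Real.sqrt 2 - 1) ^ n) / 2)
      (((Real.sqrt 2 + 1) ^ n - (Real.sqrt 2 - 1) ^ n) / 2) := by
  obtain ⟨x, y, hx, hn, hu, hv⟩ := exists_coords_unit_pow n
  refine ⟨hpos, ?_⟩
  rcases n.even_or_odd with he | ho
  · rw [he.neg_one_pow] at hn hv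
    exact ⟨Real.sqrt 2 * y, x, Or.inl (Or.inl ⟨x, y, y, x, hx, hx, by linarith,
      by linarith, rfl, by linarith, rfl⟩)⟩
  · rw [ho.neg_one_pow] at hn hv
    exact ⟨x, Real.sqrt 2 * y, Or.inl (Or.inr ⟨y, x, x, y, hx, hx, by linarith,
      by linarith, rfl, by linarith, rfl⟩)⟩

/-- An approximation of `1` that beats the `n`-th optimal one has at least the denominator of the
next optimal one. -/
theorem QH4.le_of_abs_sub_lt {p q : ℝ} (h : QH4 p q) (hq : 1 ≤ q) {n : ℕ}
    (hlt : |q - p| < (Real.sqrt 2 - 1) ^ n) :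
    ((Real.sqrt 2 + 1) ^ (n + 1) - (Real.sqrt 2 - 1) ^ (n + 1)) / 2 ≤ q := by
  have h1 := one_lt_sqrt_two
  have h2 := sqrt_two_lt
  have hprod : (Real.sqrt 2 + 1) ^ n * (Real.sqrt 2 - 1) ^ n = 1 := by
    rw [← mul_pow, sqrt_two_add_one_mul_sqrt_two_sub_one, one_pow]
  have hv1 : (Real.sqrt 2 - 1) ^ n ≤ 1 := pow_le_one₀ (by linarith) (by linarith)
  have hv0 : 0 < (Real.sqrt 2 - 1) ^ n := pow_pos (by linarith) n
  have hu1 : 1 ≤ (Real.sqrt 2 + 1) ^ n := one_le_pow₀ (by linarith)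
  obtain ⟨x, y, hsum, hdiff⟩ := h.exists_coords
  obtain ⟨s, t, hw, hw'⟩ := exists_coords_div_unit_pow x y n
  rw [← hsum] at hw
  rw [← hdiff] at hw'
  have hp : 0 < p := by linarith [(abs_lt.mp hlt).2]
  have hmin : p + q - |q - p| ≤ 2 * q := by linarith [neg_abs_le (q - p)]
  have hsum' : p + q = (s + Real.sqrt 2 * t) * (Real.sqrt 2 + 1) ^ n := by
    rw [← hw]; linear_combination -(p + q) * hprod
  have hdiff' : |q - p| = |(s : ℝ) - Real.sqrt 2 * t| * (Real.sqrt 2 - 1) ^ n := by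
    rw [← hw']; linear_combination -|q - p| * hprod
  have hpos : 0 < (s : ℝ) + Real.sqrt 2 * t := by
    rw [← hw]; positivity
  have hlt' : |(s : ℝ) - Real.sqrt 2 * t| < 1 := by
    rw [hdiff'] at hlt
    exact (mul_lt_iff_lt_one_left hv0).mp hlt
  rw [pow_succ, pow_succ]
  rcases eq_one_or_le_of_abs_conj_lt_one hpos hlt' with ⟨rfl, rfl⟩ | hle
  · have habs : |((1 : ℤ) : ℝ) - Real.sqrt 2 * (1 : ℤ)| = Real.sqrt 2 - 1 := by
      rw [abs_sub_comm, abs_of_pos] <;> push_cast <;> linarith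
    rw [habs] at hdiff'
    push_cast at hsum'
    linarith
  · have := mul_le_mul_of_nonneg_right hle (zero_le_one.trans hu1)
    nlinarith [mul_pos hv0 (sub_pos.mpr h1)]

theorem mem_Kset_one : (Real.sqrt 2 + 1) / 2 ∈ Kset 1 := by
  have h1 := one_lt_sqrt_two
  have h2 := sqrt_two_lt
  refine ⟨by positivity, 1, fun N hN => ?_⟩
  have hex : ∃ m : ℕ, N < ((Real.sqrt 2 + 1) ^ (m + 1) - (Real.sqrt 2 - 1) ^ (m + 1)) / 2 := by
    obtain ⟨m, hm⟩ := pow_unbounded_of_one_lt (2 * N + 1) (show 1 < Real.sqrt 2 + 1 by linarith)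
    refine ⟨m, ?_⟩
    have hv : (Real.sqrt 2 - 1) ^ (m + 1) ≤ 1 := pow_le_one₀ (by linarith) (by linarith)
    have hu : (Real.sqrt 2 + 1) ^ m ≤ (Real.sqrt 2 + 1) ^ (m + 1) :=
      pow_le_pow_right₀ (by linarith) (by omega)
    linarith
  classical
  obtain ⟨n, hn⟩ : ∃ n, Nat.find hex = n + 1 := by
    refine Nat.exists_eq_succ_of_ne_zero fun h0 => ?_
    have := Nat.find_spec hex
    rw [h0] at this
    norm_num at this
    linarith
  have hlt := Nat.find_spec hex
  have hle := not_lt.mp (Nat.find_min hex (show n < Nat.find hex by omega))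
  rw [hn] at hlt
  have hv : (Real.sqrt 2 - 1) ^ (n + 1) ≤ Real.sqrt 2 - 1 :=
    pow_le_of_le_one (by linarith) (by linarith) (by omega)
  have hu : Real.sqrt 2 + 1 ≤ (Real.sqrt 2 + 1) ^ (n + 1) :=
    le_self_pow₀ (by linarith) (by omega)
  have hv0 : 0 < (Real.sqrt 2 - 1) ^ (n + 1) := pow_pos (by linarith) _
  refine ⟨_, _, QH4_unit_pow (n := n + 1) (by linarith), ?_, by linarith, hle⟩
  have hdiff : ((Real.sqrt 2 + 1) ^ (n + 1) - (Real.sqrt 2 - 1) ^ (n + 1)) / 2 * 1 -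
      ((Real.sqrt 2 + 1) ^ (n + 1) + (Real.sqrt 2 - 1) ^ (n + 1)) / 2 =
      -(Real.sqrt 2 - 1) ^ (n + 1) := by ring
  rw [hdiff, abs_neg, abs_of_pos hv0, lt_div_iff₀ (by linarith)]
  have hprod : (Real.sqrt 2 + 1) ^ (n + 1) * (Real.sqrt 2 - 1) ^ (n + 1) = 1 := by
    rw [← mul_pow, sqrt_two_add_one_mul_sqrt_two_sub_one, one_pow]
  have hN' : N < (Real.sqrt 2 + 1) ^ (n + 1) * (Real.sqrt 2 + 1) / 2 := by
    have : 0 < (Real.sqrt 2 - 1) ^ (n + 1 + 1) := pow_pos (by linarith) _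
    rw [pow_succ (Real.sqrt 2 + 1)] at hlt
    linarith
  calc (Real.sqrt 2 - 1) ^ (n + 1) * N
      < (Real.sqrt 2 - 1) ^ (n + 1) * ((Real.sqrt 2 + 1) ^ (n + 1) * (Real.sqrt 2 + 1) / 2) := by
        gcongr
    _ = (Real.sqrt 2 + 1) / 2 := by linear_combination (Real.sqrt 2 + 1) / 2 * hprod

theorem le_of_mem_Kset_one {K : ℝ} (hK : K ∈ Kset 1) : (Real.sqrt 2 + 1) / 2 ≤ K := by
  have h1 := one_lt_sqrt_two
  have h2 := sqrt_two_lt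
  obtain ⟨hK0, N₀, hN⟩ := hK
  by_contra! hlt
  obtain ⟨n, hn⟩ := pow_unbounded_of_one_lt (max (N₀ / K) (1 / ((Real.sqrt 2 + 1) / 2 - K)))
    (show 1 < Real.sqrt 2 + 1 by linarith)
  obtain ⟨hn₁, hn₂⟩ := max_lt_iff.mp hn
  rw [div_lt_iff₀ hK0] at hn₁
  rw [div_lt_iff₀ (by linarith)] at hn₂
  obtain ⟨p, q, hQ, hpq, hq1, hqN⟩ := hN ((Real.sqrt 2 + 1) ^ n * K) hn₁.le
  have hprod : (Real.sqrt 2 + 1) ^ n * (Real.sqrt 2 - 1) ^ n = 1 := by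
    rw [← mul_pow, sqrt_two_add_one_mul_sqrt_two_sub_one, one_pow]
  have hu : 0 < (Real.sqrt 2 + 1) ^ n := by positivity
  have hKN : K / ((Real.sqrt 2 + 1) ^ n * K) = (Real.sqrt 2 - 1) ^ n := by
    rw [div_eq_iff (by positivity)]
    linear_combination -K * hprod
  rw [mul_one, hKN] at hpq
  have hle := hQ.le_of_abs_sub_lt hq1 hpq
  have hv : (Real.sqrt 2 - 1) ^ (n + 1) ≤ 1 := pow_le_one₀ (by linarith) (by linarith)
  rw [pow_succ (Real.sqrt 2 + 1)] at hle
  linarith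

theorem K_one : Kconst 1 = (Real.sqrt 2 + 1) / 2 :=
  IsLeast.csInf_eq ⟨mem_Kset_one, fun _ hK => le_of_mem_Kset_one hK⟩
end
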